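/- Let 𝔛 be a countable set and P : 𝔛 × 𝔛 → [0,1] a loop-free stochastic matrix ((P^k)_{xx} = 0 for all x, k ≥ 1), Q = ∑_{k≥1} P^k, π an initial distribution, (S_0, S_1, …) the associated Markov chain on 𝔛^ℕ, and K_{xy} = π_x + (πQ)_x − Q_{yx}. Let 𝔜 ⊆ 𝔛 be a finite subset such that trajectories which leave 𝔜 do not return: if Q_{yz} > 0 for some y ∈ 𝔜 and z ∈ 𝔛∖𝔜, then Q_{zy'} = 0 for all y' ∈ 𝔜. Let π_0 be the probability that the trajectory {S_m : m ∈ ℕ} does not intersect 𝔜, and let K_𝔜 denote the restriction of K to 𝔜 × 𝔜. Then det(1 − K_𝔜) = π_0. -/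

import Mathlib

open scoped BigOperators
open MeasureTheory

/-- Powers of a (possibly infinite) matrix `P : 𝔛 → 𝔛 → ℝ`. -/
noncomputable def powMat {𝔛 : Type*} [DecidableEq 𝔛] (P : 𝔛 → 𝔛 → ℝ) : ℕ → 𝔛 → 𝔛 → ℝ
  | 0 => fun x y => if x = y then 1 else 0
  | k + 1 => fun x y => ∑' z, powMat P k x z * P z y

/-- `Q x y = ∑_{k=1}^∞ (P^k) x y`. -/
noncomputable def Qmat {𝔛 : Type*} [DecidableEq 𝔛] (P : 𝔛 → 𝔛 → ℝ) (x y : 𝔛) : ℝ :=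
  ∑' k : ℕ, powMat P (k + 1) x y

/-- The correlation kernel `K x y = π x + (πQ) x - Q y x` of Theorem 1.1. -/
noncomputable def Kker {𝔛 : Type*} [DecidableEq 𝔛] (P : 𝔛 → 𝔛 → ℝ) (π : 𝔛 → ℝ)
    (x y : 𝔛) : ℝ :=
  π x + (∑' z, π z * Qmat P z x) - Qmat P y x

open scoped ENNReal

section Chain

variable {α : Type*} [DecidableEq α] (p : α → α → ℝ≥0∞) (v : α → ℝ≥0∞) (Y : Finset α)

/-- Powers of a matrix with entries in `ℝ≥0∞`. -/
noncomputable def ennPow : ℕ → α → α → ℝ≥0∞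
  | 0 => fun x y => if x = y then 1 else 0
  | k + 1 => fun x y => ∑' z, ennPow k x z * p z y

/-- The Green function `∑_{k ≥ 0} p ^ k`. -/
noncomputable def green (x y : α) : ℝ≥0∞ := ∑' k, ennPow p k x y

/-- Weight of the state `x` at time `n` for the chain started from `v` and killed when it
leaves a state of `Y`; for `x ∈ Y` this is the weight of first hitting `Y` at time `n` in `x`. -/
noncomputable def killed : ℕ → α → ℝ≥0∞
  | 0 => v
  | n + 1 => fun x => ∑' z, (if z ∈ Y then 0 else killed n z) * p z x

/-- The weight of first hitting `Y` in the state `x`. -/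
noncomputable def firstHit (x : α) : ℝ≥0∞ := ∑' n, killed p v Y n x

/-- The probability, starting from `x`, of avoiding `Y` at the times `1, …, n`. -/
noncomputable def avoid : ℕ → α → ℝ≥0∞
  | 0 => fun _ => 1
  | n + 1 => fun x => ∑' z, p x z * (if z ∈ Y then 0 else avoid n z)

lemma tsum_mem_add_tsum_notMem (f : α → ℝ≥0∞) :
    ∑ x ∈ Y, f x + ∑' x, (if x ∈ Y then 0 else f x) = ∑' x, f x := by
  have h : ∑ x ∈ Y, f x = ∑' x, (if x ∈ Y then f x else 0) := by
    rw [tsum_eq_sum (s := Y) (fun x hx => if_neg hx)]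
    exact Finset.sum_congr rfl fun x hx => (if_pos hx).symm
  rw [h, ← ENNReal.tsum_add]
  refine tsum_congr fun x => ?_
  split_ifs <;> simp

lemma tsum_ennPow_zero_right (f : α → ℝ≥0∞) (y : α) : ∑' x, f x * ennPow p 0 x y = f y := by
  rw [tsum_eq_single y (fun x hx => by simp [ennPow, hx])]
  simp [ennPow]

lemma ennPow_mul_le (j k : ℕ) (x y z : α) :
    ennPow p j x y * ennPow p k y z ≤ ennPow p (j + k) x z := by
  induction k generalizing z with
  | zero =>
    by_cases h : y = z
    · simp [ennPow, h]
    · simp [ennPow, h]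
  | succ k ih =>
    change _ * ∑' w, _ ≤ ∑' w, _
    rw [← ENNReal.tsum_mul_left]
    refine ENNReal.tsum_le_tsum fun w => ?_
    rw [← mul_assoc]
    exact mul_le_mul_left (ih w) _

lemma tsum_mul_ennPow (N : ℕ) (y : α) :
    ∑' z, v z * ennPow p N z y = (if y ∈ Y then 0 else killed p v Y N y) +
      ∑ ij ∈ Finset.HasAntidiagonal.antidiagonal N, ∑ x ∈ Y, killed p v Y ij.1 x * ennPow p ij.2 x y := by
  have key (f : α → ℝ≥0∞) (y : α) :
      ∑ x ∈ Y, f x * ennPow p 0 x y = if y ∈ Y then f y else 0 := by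
    simp [ennPow]
  induction N generalizing y with
  | zero =>
    rw [tsum_ennPow_zero_right]
    simp only [Finset.Nat.antidiagonal_zero, Finset.sum_singleton, key]
    split_ifs <;> simp [killed]
  | succ N ih =>
    have step : ∑' z, v z * ennPow p (N + 1) z y =
        ∑' w, (∑' z, v z * ennPow p N z w) * p w y := by
      simp only [ennPow, ← ENNReal.tsum_mul_left, ← ENNReal.tsum_mul_right]
      rw [ENNReal.tsum_comm]
      simp only [mul_assoc]
    rw [step, Finset.Nat.sum_antidiagonal_succ', key, ← add_assoc]
    have hsplit : ((if y ∈ Y then 0 else killed p v Y (N + 1) y) +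
        if y ∈ Y then killed p v Y (N + 1) y else 0) = killed p v Y (N + 1) y := by
      split_ifs <;> simp
    simp only [hsplit, ih, add_mul, ENNReal.tsum_add]
    congr 1
    simp only [Finset.sum_mul]
    rw [Summable.tsum_finsetSum fun _ _ => ENNReal.summable]
    refine Finset.sum_congr rfl fun ij _ => ?_
    rw [Summable.tsum_finsetSum fun _ _ => ENNReal.summable]
    refine Finset.sum_congr rfl fun x _ => ?_
    simp only [mul_assoc, ENNReal.tsum_mul_left, ennPow]

lemma ennreal_tsum_antidiagonal (f g : ℕ → ℝ≥0∞) :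
    ∑' n, ∑ ij ∈ Finset.HasAntidiagonal.antidiagonal n, f ij.1 * g ij.2 = (∑' n, f n) * ∑' n, g n := by
  simp_rw [← ENNReal.tsum_mul_right, ← ENNReal.tsum_mul_left]
  rw [← ENNReal.tsum_prod (f := fun i j => f i * g j),
    ← Finset.HasAntidiagonal.sigmaAntidiagonalEquivProd.tsum_eq, ENNReal.tsum_sigma']
  refine tsum_congr fun n => ?_
  rw [tsum_fintype, ← Finset.sum_coe_sort]
  rfl

/-- First-passage decomposition of the Green function. -/
lemma tsum_mul_green {y : α} (hy : y ∈ Y) :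
    ∑' z, v z * green p z y = ∑ x ∈ Y, firstHit p v Y x * green p x y := by
  simp only [green, firstHit, ← ennreal_tsum_antidiagonal]
  rw [← Summable.tsum_finsetSum fun _ _ => ENNReal.summable]
  simp only [← ENNReal.tsum_mul_left]
  rw [ENNReal.tsum_comm]
  refine tsum_congr fun N => ?_
  rw [tsum_mul_ennPow p v Y N y, if_pos hy, zero_add, Finset.sum_comm]

variable {p}

lemma tsum_killed_eq (hp : ∀ x, ∑' y, p x y = 1) (n : ℕ) :
    ∑ x ∈ Y, killed p v Y n x + ∑' x, killed p v Y (n + 1) x = ∑' x, killed p v Y n x := by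
  rw [← tsum_mem_add_tsum_notMem Y (killed p v Y n)]
  congr 1
  simp only [killed]
  rw [ENNReal.tsum_comm]
  simp only [ENNReal.tsum_mul_left, hp, mul_one]

lemma sum_range_killed (hp : ∀ x, ∑' y, p x y = 1) (n : ℕ) :
    ∑ i ∈ Finset.range n, ∑ x ∈ Y, killed p v Y i x + ∑' x, killed p v Y n x = ∑' x, v x := by
  induction n with
  | zero => simp [killed]
  | succ n ih => rw [Finset.sum_range_succ, add_assoc, tsum_killed_eq v Y hp, ih]

lemma sum_firstHit : ∑ x ∈ Y, firstHit p v Y x = ∑' n, ∑ x ∈ Y, killed p v Y n x :=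
  (Summable.tsum_finsetSum fun _ _ => ENNReal.summable).symm

lemma sum_firstHit_le (hp : ∀ x, ∑' y, p x y = 1) : ∑ x ∈ Y, firstHit p v Y x ≤ ∑' x, v x := by
  rw [sum_firstHit, ENNReal.tsum_eq_iSup_nat]
  exact iSup_le fun n => sum_range_killed v Y hp n ▸ le_self_add

lemma green_self (hloop : ∀ x k, 1 ≤ k → ennPow p k x x = 0) (x : α) : green p x x = 1 := by
  rw [green, tsum_eq_single 0 fun k hk => hloop x k (Nat.one_le_iff_ne_zero.2 hk)]
  simp [ennPow]

lemma green_le_one (hp : ∀ x, ∑' y, p x y = 1)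
    (hloop : ∀ x k, 1 ≤ k → ennPow p k x x = 0) (x y : α) : green p x y ≤ 1 := by
  have h := tsum_mul_green p (fun z => if z = x then 1 else 0) {y} (Finset.mem_singleton_self y)
  have h' := sum_firstHit_le (fun z => if z = x then 1 else 0) {y} hp
  simp only [ite_mul, one_mul, zero_mul, tsum_ite_eq, Finset.sum_singleton,
    green_self hloop, mul_one] at h h'
  exact h ▸ h'

lemma tsum_killed_mul_avoid (k n : ℕ) :
    ∑' z, (if z ∈ Y then 0 else killed p v Y k z) * avoid p Y (n + 1) z =
      ∑' z, (if z ∈ Y then 0 else killed p v Y (k + 1) z) * avoid p Y n z := by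
  simp only [avoid, ← ENNReal.tsum_mul_left]
  rw [ENNReal.tsum_comm]
  refine tsum_congr fun z => ?_
  simp only [killed]
  split_ifs
  · simp
  · simp only [← mul_assoc, ENNReal.tsum_mul_right]

lemma tsum_mul_avoid (hp : ∀ x, ∑' y, p x y = 1) (n : ℕ) :
    ∑' z, (if z ∈ Y then 0 else v z) * avoid p Y n z = ∑' z, killed p v Y (n + 1) z := by
  have h : ∀ k, ∑' z, (if z ∈ Y then 0 else killed p v Y k z) * avoid p Y n z =
      ∑' z, killed p v Y (k + n + 1) z := by
    induction n with
    | zero =>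
      intro k
      simp only [avoid, mul_one, killed]
      rw [ENNReal.tsum_comm]
      simp only [ENNReal.tsum_mul_left, hp, mul_one]
    | succ n ih =>
      intro k
      rw [tsum_killed_mul_avoid, ih, add_right_comm k 1 n]
      rfl
  simpa [killed] using h 0

lemma exists_ennPow_ne_zero {x y : α} (h : green p x y ≠ 0) :
    ∃ k, ennPow p k x y ≠ 0 := by
  simpa [green] using h

lemma green_ne_zero_trans {x y z : α} (hxy : green p x y ≠ 0) (hyz : green p y z ≠ 0) :
    green p x z ≠ 0 := by
  obtain ⟨j, hj⟩ := exists_ennPow_ne_zero hxy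
  obtain ⟨k, hk⟩ := exists_ennPow_ne_zero hyz
  intro h
  have h0 : ennPow p (j + k) x z = 0 := (ENNReal.tsum_eq_zero.1 h) _
  exact mul_ne_zero hj hk (le_zero_iff.1 (h0 ▸ ennPow_mul_le p j k x y z))

lemma green_antisymm (hloop : ∀ x k, 1 ≤ k → ennPow p k x x = 0) {x y : α}
    (hxy : green p x y ≠ 0) (hyx : green p y x ≠ 0) : x = y := by
  by_contra hne
  obtain ⟨j, hj⟩ := exists_ennPow_ne_zero hxy
  obtain ⟨k, hk⟩ := exists_ennPow_ne_zero hyx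
  have hj1 : 1 ≤ j := by
    rcases Nat.eq_zero_or_pos j with rfl | h
    · simp [ennPow, hne] at hj
    · exact h
  have h0 := hloop x (j + k) (by omega)
  exact mul_ne_zero hj hk (le_zero_iff.1 (h0 ▸ ennPow_mul_le p j k x y x))

end Chain

/-- A matrix supported on a partial order with unit diagonal has determinant one. -/
lemma Matrix.det_eq_one_of_support {ι R : Type*} [Fintype ι] [DecidableEq ι] [CommRing R]
    (A : Matrix ι ι R) (r : ι → ι → Prop) (htrans : ∀ x y z, r x y → r y z → r x z)
    (hanti : ∀ x y, r x y → r y x → x = y) (hA : ∀ x y, A x y ≠ 0 → r x y)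
    (hdiag : ∀ x, A x x = 1) : A.det = 1 := by
  classical
  let b : ι → ℕ := fun x => (Finset.univ.filter fun y => y ≠ x ∧ r x y).card
  have hb : ∀ x y, x ≠ y → r x y → b y < b x := by
    intro x y hne hxy
    refine Finset.card_lt_card ((Finset.ssubset_iff_of_subset ?_).2 ⟨y, ?_, ?_⟩)
    · intro z hz
      simp only [Finset.mem_filter, Finset.mem_univ, true_and] at hz ⊢
      refine ⟨?_, htrans _ _ _ hxy hz.2⟩
      rintro rfl
      exact hne (hanti _ _ hxy hz.2)
    · simpa using ⟨hne.symm, hxy⟩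
    · simp
  rw [Matrix.det_apply', Finset.sum_eq_single 1]
  · simp [hdiag]
  · intro σ _ hσ
    suffices ∃ i, A (σ i) i = 0 by
      obtain ⟨i, hi⟩ := this
      exact mul_eq_zero_of_right _ (Finset.prod_eq_zero (Finset.mem_univ i) hi)
    by_contra! hne
    obtain ⟨i, hi⟩ : ∃ i, σ i ≠ i := by
      by_contra! h
      exact hσ (Equiv.ext h)
    have hlt : ∑ i, b i < ∑ i, b (σ i) := by
      refine Finset.sum_lt_sum (fun j _ => ?_) ⟨i, Finset.mem_univ i, hb _ _ hi (hA _ _ (hne i))⟩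
      by_cases hj : σ j = j
      · rw [hj]
      · exact (hb _ _ hj (hA _ _ (hne j))).le
    exact hlt.ne (Equiv.sum_comp σ b).symm
  · simp

section Measure

open Filter Topology

variable {α : Type*} [Countable α] [MeasurableSpace α] [MeasurableSingletonClass α]

lemma measure_eq_tsum_coord (μ : Measure (ℕ → α)) (m : ℕ) (S : Set (ℕ → α)) :
    μ S = ∑' z, μ {ω | ω m = z ∧ ω ∈ S} := by
  have hm : ∀ z : α, MeasurableSet ((fun ω : ℕ → α => ω m) ⁻¹' {z}) := fun z =>
    measurable_pi_apply m (measurableSet_singleton z)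
  have h := tsum_measure_preimage_singleton (μ := μ.restrict S) (Set.countable_univ (α := α))
    (f := fun ω : ℕ → α => ω m) fun z _ => hm z
  rw [Set.preimage_univ, Measure.restrict_apply_univ,
    tsum_univ fun z => μ.restrict S ((fun ω : ℕ → α => ω m) ⁻¹' {z})] at h
  rw [← h]
  exact tsum_congr fun z => Measure.restrict_apply (hm z)

variable [DecidableEq α] {p : α → α → ℝ≥0∞} {v : α → ℝ≥0∞} {μ : Measure (ℕ → α)}

lemma measure_cylinder_avoid
    (hμ : ∀ (n : ℕ) (x : ℕ → α), μ {ω | ∀ i ≤ n, ω i = x i} =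
      v (x 0) * ∏ i ∈ Finset.range n, p (x i) (x (i + 1)))
    (Y : Finset α) (n m : ℕ) (s : ℕ → α) :
    μ {ω | (∀ i ≤ m, ω i = s i) ∧ ∀ i, m < i → i ≤ m + n → ω i ∉ Y} =
      (v (s 0) * ∏ i ∈ Finset.range m, p (s i) (s (i + 1))) * avoid p Y n (s m) := by
  induction n generalizing m s with
  | zero =>
    rw [← hμ m s, avoid, mul_one]
    congr 1
    ext ω
    exact and_iff_left fun i h1 h2 => by omega
  | succ n ih =>
    rw [measure_eq_tsum_coord μ (m + 1), avoid, ← ENNReal.tsum_mul_left]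
    refine tsum_congr fun z => ?_
    split_ifs with hz
    · rw [mul_zero, mul_zero]
      convert measure_empty (μ := μ)
      ext ω
      simp only [Set.mem_ofPred_eq, Set.mem_empty_iff_false, iff_false]
      rintro ⟨h1, -, h2⟩
      exact h2 (m + 1) (by omega) (by omega) (h1 ▸ hz)
    · have hs : ∀ i ≤ m, Function.update s (m + 1) z i = s i := fun i hi =>
        Function.update_of_ne (by omega) _ _
      have h := ih (m + 1) (Function.update s (m + 1) z)
      rw [Finset.prod_range_succ, Function.update_self, hs 0 (Nat.zero_le _), hs m le_rfl,
        Finset.prod_congr rfl fun i hi => by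
          rw [hs i (Finset.mem_range.1 hi).le, hs (i + 1) (Finset.mem_range.1 hi)]] at h
      rw [← mul_assoc, mul_assoc (v (s 0)), ← h]
      congr 1
      ext ω
      simp only [Set.mem_ofPred_eq]
      constructor
      · rintro ⟨h1, h2, h3⟩
        refine ⟨fun i hi => ?_, fun i h4 h5 => h3 i (by omega) (by omega)⟩
        rcases hi.eq_or_lt with rfl | hi
        · rw [h1, Function.update_self]
        · rw [hs i (by omega), h2 i (by omega)]
      · rintro ⟨h1, h2⟩
        have hm := h1 (m + 1) le_rfl
        rw [Function.update_self] at hm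
        refine ⟨hm, fun i hi => by rw [h1 i (by omega), hs i hi], fun i h4 h5 => ?_⟩
        rcases (Nat.succ_le_of_lt h4).eq_or_lt with rfl | h6
        · exact hm ▸ hz
        · exact h2 i h6 (by omega)

lemma measure_avoid
    (hμ : ∀ (n : ℕ) (x : ℕ → α), μ {ω | ∀ i ≤ n, ω i = x i} =
      v (x 0) * ∏ i ∈ Finset.range n, p (x i) (x (i + 1)))
    (hp : ∀ x, ∑' y, p x y = 1) (Y : Finset α) (n : ℕ) :
    μ {ω | ∀ i ≤ n, ω i ∉ Y} = ∑' x, killed p v Y (n + 1) x := by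
  rw [← tsum_mul_avoid v Y hp, measure_eq_tsum_coord μ 0]
  refine tsum_congr fun z => ?_
  split_ifs with hz
  · rw [zero_mul]
    convert measure_empty (μ := μ)
    ext ω
    simp only [Set.mem_ofPred_eq, Set.mem_empty_iff_false, iff_false]
    rintro ⟨h1, h2⟩
    exact h2 0 (Nat.zero_le _) (h1 ▸ hz)
  · have h := measure_cylinder_avoid hμ Y n 0 fun _ => z
    rw [Finset.range_zero, Finset.prod_empty, mul_one] at h
    rw [← h]
    congr 1
    ext ω
    simp only [Set.mem_ofPred_eq, Nat.le_zero, forall_eq, zero_add]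
    refine and_congr_right fun h0 => ⟨fun h i _ hi => h i hi, fun h i hi => ?_⟩
    rcases Nat.eq_zero_or_pos i with rfl | hi0
    · exact h0 ▸ hz
    · exact h i hi0 hi

/-- Either the chain hits `Y`, or it avoids it forever. -/
lemma sum_firstHit_add_measure
    (hμ : ∀ (n : ℕ) (x : ℕ → α), μ {ω | ∀ i ≤ n, ω i = x i} =
      v (x 0) * ∏ i ∈ Finset.range n, p (x i) (x (i + 1)))
    (hp : ∀ x, ∑' y, p x y = 1) (hv : ∑' x, v x = 1) (Y : Finset α) :
    ∑ x ∈ Y, firstHit p v Y x + μ {ω | ∀ m, ω m ∉ Y} = 1 := by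
  have hmass := sum_range_killed (p := p) v Y hp
  have hlim : Tendsto (fun n => μ {ω | ∀ i ≤ n, ω i ∉ Y}) atTop
      (𝓝 (μ {ω | ∀ m, ω m ∉ Y})) := by
    have hset : {ω : ℕ → α | ∀ m, ω m ∉ Y} = ⋂ n, {ω | ∀ i ≤ n, ω i ∉ Y} := by
      ext ω
      simp only [Set.mem_ofPred_eq, Set.mem_iInter]
      exact ⟨fun h n i _ => h i, fun h m => h m m le_rfl⟩
    rw [hset]
    refine tendsto_measure_iInter_atTop (fun n => MeasurableSet.nullMeasurableSet ?_)
      (fun a b hab ω h i hi => h i (hi.trans hab)) ⟨0, ?_⟩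
    · have : {ω : ℕ → α | ∀ i ≤ n, ω i ∉ Y} =
          ⋂ i, ⋂ (_ : i ≤ n), (fun ω : ℕ → α => ω i) ⁻¹' (Y : Set α)ᶜ := by
        ext ω
        simp
      rw [this]
      exact MeasurableSet.iInter fun i => MeasurableSet.iInter fun _ =>
        measurable_pi_apply i (Set.to_countable _).measurableSet
    · rw [measure_avoid hμ hp]
      exact ne_top_of_le_ne_top ENNReal.one_ne_top
        (hv ▸ hmass (0 + 1) ▸ le_add_self)
  have hsum := (ENNReal.tendsto_nat_tsum fun n => ∑ x ∈ Y, killed p v Y n x).comp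
    (tendsto_add_atTop_nat 1)
  rw [← sum_firstHit] at hsum
  refine tendsto_nhds_unique (hsum.add hlim) ?_
  simp only [Function.comp_apply, measure_avoid hμ hp, hmass, hv, tendsto_const_nhds]

end Measure

lemma summable_of_tsum_eq_one {ι : Type*} {f : ι → ℝ} (h : ∑' i, f i = 1) : Summable f := by
  by_contra hf
  rw [tsum_eq_zero_of_not_summable hf] at h
  exact zero_ne_one h

lemma tsum_ofReal_eq_one {ι : Type*} {f : ι → ℝ} (h0 : ∀ i, 0 ≤ f i) (h : ∑' i, f i = 1) :
    ∑' i, ENNReal.ofReal (f i) = 1 := by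
  rw [← ENNReal.ofReal_tsum_of_nonneg h0 (summable_of_tsum_eq_one h), h, ENNReal.ofReal_one]

section Conversion

variable {α : Type*} [DecidableEq α]

lemma tsum_ennPow {p : α → α → ℝ≥0∞} (hp : ∀ x, ∑' y, p x y = 1) (k : ℕ) (x : α) :
    ∑' y, ennPow p k x y = 1 := by
  induction k with
  | zero => simp [ennPow]
  | succ k ih =>
    simp only [ennPow]
    rw [ENNReal.tsum_comm]
    simp only [ENNReal.tsum_mul_left, hp, mul_one, ih]

lemma ennPow_ne_top {p : α → α → ℝ≥0∞} (hp : ∀ x, ∑' y, p x y = 1) (k : ℕ) (x y : α) :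
    ennPow p k x y ≠ ∞ :=
  ne_top_of_le_ne_top ENNReal.one_ne_top (tsum_ennPow hp k x ▸ ENNReal.le_tsum y)

lemma powMat_eq_toReal {P : α → α → ℝ} (hP0 : ∀ x y, 0 ≤ P x y)
    (hp : ∀ x, ∑' y, ENNReal.ofReal (P x y) = 1) (k : ℕ) (x y : α) :
    powMat P k x y = (ennPow (fun x y => ENNReal.ofReal (P x y)) k x y).toReal := by
  induction k generalizing y with
  | zero =>
    simp only [powMat, ennPow]
    split_ifs <;> simp
  | succ k ih =>
    simp only [powMat, ennPow]
    rw [ENNReal.tsum_toReal_eq fun z =>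
      ENNReal.mul_ne_top (ennPow_ne_top hp k x z) ENNReal.ofReal_ne_top]
    refine tsum_congr fun z => ?_
    rw [ih, ENNReal.toReal_mul, ENNReal.toReal_ofReal (hP0 z y)]

lemma Qmat_eq_toReal {P : α → α → ℝ} (hP0 : ∀ x y, 0 ≤ P x y)
    (hp : ∀ x, ∑' y, ENNReal.ofReal (P x y) = 1) (x y : α) :
    Qmat P x y = (∑' k, ennPow (fun x y => ENNReal.ofReal (P x y)) (k + 1) x y).toReal := by
  rw [ENNReal.tsum_toReal_eq fun k => ennPow_ne_top hp _ x y]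
  exact tsum_congr fun k => powMat_eq_toReal hP0 hp _ x y

end Conversion

/-- First assertion of Theorem 1.3: for a finite "no-return" window `𝔜`,
`det (1 - K_𝔜)` equals the probability `π₀` that the trajectory avoids `𝔜`. -/
theorem det_one_sub_K_eq_gap_probability {𝔛 : Type*} [Countable 𝔛] [DecidableEq 𝔛]
    [MeasurableSpace 𝔛] [MeasurableSingletonClass 𝔛]
    (P : 𝔛 → 𝔛 → ℝ) (π : 𝔛 → ℝ)
    (hP0 : ∀ x y, 0 ≤ P x y) (hP1 : ∀ x y, P x y ≤ 1)
    (hstoch : ∀ x, ∑' y, P x y = 1)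
    (hloop : ∀ (x : 𝔛) (k : ℕ), 1 ≤ k → powMat P k x x = 0)
    (hπ0 : ∀ x, 0 ≤ π x) (hπ1 : ∑' x, π x = 1)
    (μ : Measure (ℕ → 𝔛))
    (hμ : ∀ (n : ℕ) (x : ℕ → 𝔛),
      μ {ω | ∀ i ≤ n, ω i = x i} =
        ENNReal.ofReal (π (x 0) * ∏ i ∈ Finset.range n, P (x i) (x (i + 1))))
    (𝔜 : Finset 𝔛)
    (hnoreturn : ∀ y ∈ 𝔜, ∀ z ∉ 𝔜, 0 < Qmat P y z → ∀ y' ∈ 𝔜, Qmat P z y' = 0) :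
    Matrix.det (1 - Matrix.of fun x y : ↥𝔜 => Kker P π (x : 𝔛) (y : 𝔛)) =
      (μ {ω | ∀ m : ℕ, ω m ∉ 𝔜}).toReal := by
  set p : 𝔛 → 𝔛 → ℝ≥0∞ := fun x y => ENNReal.ofReal (P x y)
  set v : 𝔛 → ℝ≥0∞ := fun x => ENNReal.ofReal (π x)
  have hp : ∀ x, ∑' y, p x y = 1 := fun x => tsum_ofReal_eq_one (hP0 x) (hstoch x)
  have hv : ∑' x, v x = 1 := tsum_ofReal_eq_one hπ0 hπ1
  have hcyl : ∀ (n : ℕ) (x : ℕ → 𝔛), μ {ω | ∀ i ≤ n, ω i = x i} =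
      v (x 0) * ∏ i ∈ Finset.range n, p (x i) (x (i + 1)) := by
    intro n x
    rw [hμ, ENNReal.ofReal_mul (hπ0 _), ENNReal.ofReal_prod_of_nonneg fun _ _ => hP0 _ _]
  have hloop' : ∀ x k, 1 ≤ k → ennPow p k x x = 0 := by
    intro x k hk
    have h := hloop x k hk
    rw [powMat_eq_toReal hP0 hp, ENNReal.toReal_eq_zero_iff] at h
    exact h.resolve_right (ennPow_ne_top hp k x x)
  set q : 𝔛 → 𝔛 → ℝ≥0∞ := fun x y => ∑' k, ennPow p (k + 1) x y
  have hgreen : ∀ x y, green p x y = (if x = y then 1 else 0) + q x y := fun x y =>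
    tsum_eq_zero_add' ENNReal.summable
  have hg1 := green_le_one hp hloop'
  have hgtop : ∀ x y, green p x y ≠ ∞ := fun x y =>
    ne_top_of_le_ne_top ENNReal.one_ne_top (hg1 x y)
  have hqtop : ∀ x y, q x y ≠ ∞ := fun x y =>
    ne_top_of_le_ne_top (hgtop x y) (hgreen x y ▸ le_add_self)
  have hQ : ∀ x y, Qmat P x y = (q x y).toReal := Qmat_eq_toReal hP0 hp
  have hG : ∀ x y, (green p x y).toReal = (if x = y then 1 else 0) + Qmat P x y := by
    intro x y
    rw [hgreen, ENNReal.toReal_add (by split_ifs <;> simp) (hqtop x y), hQ]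
    split_ifs <;> simp
  have htotal := sum_firstHit_add_measure hcyl hp hv 𝔜
  have hftop : ∀ x ∈ 𝔜, firstHit p v 𝔜 x ≠ ∞ := fun x hx =>
    ne_top_of_le_ne_top ENNReal.one_ne_top
      ((Finset.single_le_sum_of_canonicallyOrdered hx).trans (htotal ▸ le_self_add))
  -- the hitting probability of `x`
  have hρ : ∀ x, π x + ∑' z, π z * Qmat P z x = (∑' z, v z * green p z x).toReal := by
    intro x
    have hle : ∑' z, v z * q z x ≤ 1 := by
      rw [← hv]
      exact ENNReal.tsum_le_tsum fun z =>
        mul_le_of_le_one_right' ((hgreen z x ▸ le_add_self).trans (hg1 z x))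
    have h0 := tsum_ennPow_zero_right p v x
    simp only [ennPow] at h0
    simp only [hgreen, mul_add, ENNReal.tsum_add]
    rw [h0, ENNReal.toReal_add ENNReal.ofReal_ne_top (ne_top_of_le_ne_top ENNReal.one_ne_top hle),
      ENNReal.toReal_ofReal (hπ0 x), ENNReal.tsum_toReal_eq fun z =>
        ENNReal.mul_ne_top ENNReal.ofReal_ne_top (hqtop z x)]
    congr 1
    refine tsum_congr fun z => ?_
    rw [ENNReal.toReal_mul, hQ, ENNReal.toReal_ofReal (hπ0 z)]
  let A : Matrix 𝔜 𝔜 ℝ := Matrix.of fun x y => (green p (x : 𝔛) y).toReal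
  let f : 𝔜 → ℝ := fun x => (firstHit p v 𝔜 x).toReal
  let U : Matrix 𝔜 Unit ℝ := Matrix.of fun x _ => f x
  let W : Matrix Unit 𝔜 ℝ := Matrix.of fun _ _ => 1
  have hA : A.det = 1 := by
    refine A.det_eq_one_of_support (fun x y => green p (x : 𝔛) y ≠ 0)
      (fun _ _ _ => green_ne_zero_trans) (fun x y hxy hyx =>
        Subtype.ext (green_antisymm hloop' hxy hyx)) (fun x y h h0 => h ?_) fun x => ?_
    · simp [A, h0]
    · simp [A, green_self hloop']
  have hfac : 1 - Matrix.of (fun x y : ↥𝔜 => Kker P π (x : 𝔛) (y : 𝔛)) =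
      A.transpose * (1 - U * W) := by
    ext x y
    have hx : π (x : 𝔛) + ∑' z, π z * Qmat P z x = ∑ z : 𝔜, A z x * f z := by
      rw [hρ, tsum_mul_green p v 𝔜 x.2, ENNReal.toReal_sum fun z hz =>
        ENNReal.mul_ne_top (hftop z hz) (hgtop z x), ← Finset.sum_coe_sort]
      refine Finset.sum_congr rfl fun z _ => ?_
      rw [ENNReal.toReal_mul, mul_comm]
      rfl
    have hAyx : A y x = (if x = y then 1 else 0) + Qmat P y x := by
      change (green p (y : 𝔛) x).toReal = _
      rw [hG]
      simp only [Subtype.ext_iff, eq_comm]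
    rw [Matrix.mul_sub, Matrix.mul_one, ← Matrix.mul_assoc]
    simp only [Matrix.sub_apply, Matrix.one_apply, Matrix.of_apply, Kker, hx,
      Matrix.transpose_apply, hAyx, Matrix.mul_apply, U, W, Finset.univ_unique,
      Finset.sum_singleton, mul_one]
    ring
  rw [hfac, Matrix.det_mul, Matrix.det_transpose, hA, one_mul,
    Matrix.det_one_sub_mul_comm, Matrix.det_unique]
  have hreal := congrArg ENNReal.toReal htotal
  rw [ENNReal.toReal_add
    (ne_top_of_le_ne_top ENNReal.one_ne_top (htotal ▸ le_self_add))
    (ne_top_of_le_ne_top ENNReal.one_ne_top (htotal ▸ le_add_self)),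
    ENNReal.toReal_sum hftop, ← Finset.sum_coe_sort, ENNReal.toReal_one] at hreal
  simp only [Matrix.sub_apply, Matrix.one_apply_eq, Matrix.mul_apply, Matrix.of_apply, U, W,
    one_mul]
  linarith
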